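/- arXiv:0909.1486 — 2 statements merged into one kernel-verified Lean document; each statement's English description precedes it below -/
import Mathlib

section
/- If a category 𝒜 carries all the data of a braided Ann-category and satisfies all the axioms of a braided Ann-category except possibly diagrams (2) and (3), then diagrams (2) and (3) automatically commute. (In particular, diagram (3) follows from diagrams (1), (6), the hexagon axioms and naturality, and diagram (2) follows from diagrams (1), (6), the hexagon axioms, naturality, and the a⁺-compatibility of the distributivity ⊕-functors.) -/
open CategoryTheory

universe v u

namespace AnnCat

variable (C : Type u) [Category.{v} C]

/-- A bifunctor `C × C → C`, given by object and morphism assignments. -/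
structure Bifunc where
  obj : C → C → C
  map : ∀ {A B X Y : C}, (A ⟶ B) → (X ⟶ Y) → (obj A X ⟶ obj B Y)
  map_id : ∀ (A X : C), map (𝟙 A) (𝟙 X) = 𝟙 (obj A X)
  map_comp : ∀ {A B E X Y Z : C} (f : A ⟶ B) (g : B ⟶ E) (h : X ⟶ Y) (k : Y ⟶ Z),
      map (f ≫ g) (h ≫ k) = map f h ≫ map g k

/-- All the data of a braided Ann-category: two bifunctors `⊕` (`pl`) and `⊗` (`tn`),
objects `0`, `1`, and the natural isomorphisms
`a⁺` (`aP`), `c⁺` (`cP`), `g`, `d`, `a`, `l`, `r`, `𝔏` (`dl`), `ℜ` (`dr`) and the braiding `c` (`br`). -/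
structure Data where
  pl : Bifunc C
  tn : Bifunc C
  zero : C
  one : C
  aP : ∀ A B X : C, pl.obj A (pl.obj B X) ≅ pl.obj (pl.obj A B) X
  cP : ∀ A B : C, pl.obj A B ≅ pl.obj B A
  g : ∀ A : C, pl.obj zero A ≅ A
  d : ∀ A : C, pl.obj A zero ≅ A
  a : ∀ A B X : C, tn.obj A (tn.obj B X) ≅ tn.obj (tn.obj A B) X
  l : ∀ A : C, tn.obj one A ≅ A
  r : ∀ A : C, tn.obj A one ≅ A
  dl : ∀ A X Y : C, tn.obj A (pl.obj X Y) ≅ pl.obj (tn.obj A X) (tn.obj A Y)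
  dr : ∀ X Y A : C, tn.obj (pl.obj X Y) A ≅ pl.obj (tn.obj X A) (tn.obj Y A)
  br : ∀ A B : C, tn.obj A B ≅ tn.obj B A
  natAP : ∀ {A A' B B' X X' : C} (f : A ⟶ A') (h : B ⟶ B') (k : X ⟶ X'),
      pl.map f (pl.map h k) ≫ (aP A' B' X').hom = (aP A B X).hom ≫ pl.map (pl.map f h) k
  natCP : ∀ {A A' B B' : C} (f : A ⟶ A') (h : B ⟶ B'),
      pl.map f h ≫ (cP A' B').hom = (cP A B).hom ≫ pl.map h f
  natG : ∀ {A A' : C} (f : A ⟶ A'), pl.map (𝟙 zero) f ≫ (g A').hom = (g A).hom ≫ f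
  natD : ∀ {A A' : C} (f : A ⟶ A'), pl.map f (𝟙 zero) ≫ (d A').hom = (d A).hom ≫ f
  natA : ∀ {A A' B B' X X' : C} (f : A ⟶ A') (h : B ⟶ B') (k : X ⟶ X'),
      tn.map f (tn.map h k) ≫ (a A' B' X').hom = (a A B X).hom ≫ tn.map (tn.map f h) k
  natL : ∀ {A A' : C} (f : A ⟶ A'), tn.map (𝟙 one) f ≫ (l A').hom = (l A).hom ≫ f
  natR : ∀ {A A' : C} (f : A ⟶ A'), tn.map f (𝟙 one) ≫ (r A').hom = (r A).hom ≫ f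
  natDL : ∀ {A A' X X' Y Y' : C} (f : A ⟶ A') (h : X ⟶ X') (k : Y ⟶ Y'),
      tn.map f (pl.map h k) ≫ (dl A' X' Y').hom
        = (dl A X Y).hom ≫ pl.map (tn.map f h) (tn.map f k)
  natDR : ∀ {X X' Y Y' A A' : C} (h : X ⟶ X') (k : Y ⟶ Y') (f : A ⟶ A'),
      tn.map (pl.map h k) f ≫ (dr X' Y' A').hom
        = (dr X Y A).hom ≫ pl.map (tn.map h f) (tn.map k f)
  natBr : ∀ {A A' B B' : C} (f : A ⟶ A') (h : B ⟶ B'),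
      tn.map f h ≫ (br A' B').hom = (br A B).hom ≫ tn.map h f

variable {C}

/-- The canonical "middle four interchange" morphism
`v : (U⊕V)⊕(Z⊕T) → (U⊕Z)⊕(V⊕T)` built from `a⁺`, `c⁺`, `id`. -/
def v (D : Data C) (U V Z T : C) :
    D.pl.obj (D.pl.obj U V) (D.pl.obj Z T) ⟶ D.pl.obj (D.pl.obj U Z) (D.pl.obj V T) :=
  (D.aP U V (D.pl.obj Z T)).inv ≫
    D.pl.map (𝟙 U)
      ((D.aP V Z T).hom ≫ D.pl.map (D.cP V Z).hom (𝟙 T) ≫ (D.aP Z V T).inv) ≫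
    (D.aP U Z (D.pl.obj V T)).hom

/-! Coherence axioms for `(𝒜, ⊕, a⁺, c⁺, (0,g,d))`. -/

def pentP (D : Data C) : Prop := ∀ W X Y Z : C,
  D.pl.map (𝟙 W) (D.aP X Y Z).hom ≫ (D.aP W (D.pl.obj X Y) Z).hom
      ≫ D.pl.map (D.aP W X Y).hom (𝟙 Z)
    = (D.aP W X (D.pl.obj Y Z)).hom ≫ (D.aP (D.pl.obj W X) Y Z).hom

def triP (D : Data C) : Prop := ∀ X Y : C,
  (D.aP X D.zero Y).hom ≫ D.pl.map (D.d X).hom (𝟙 Y) = D.pl.map (𝟙 X) (D.g Y).hom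

def hexP (D : Data C) : Prop := ∀ X Y Z : C,
  (D.aP X Y Z).inv ≫ (D.cP X (D.pl.obj Y Z)).hom ≫ (D.aP Y Z X).inv
    = D.pl.map (D.cP X Y).hom (𝟙 Z) ≫ (D.aP Y X Z).inv ≫ D.pl.map (𝟙 Y) (D.cP X Z).hom

def symP (D : Data C) : Prop := ∀ A B : C,
  (D.cP A B).hom ≫ (D.cP B A).hom = 𝟙 (D.pl.obj A B)

/-- Every object has an inverse with respect to `⊕`. -/
def invObjP (D : Data C) : Prop := ∀ A : C, ∃ A' : C, Nonempty (D.pl.obj A A' ≅ D.zero)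

/-- The underlying category is a groupoid. -/
def grpdP (C : Type u) [Category.{v} C] : Prop := ∀ {X Y : C} (f : X ⟶ Y), IsIso f

/-! Coherence axioms for `(𝒜, ⊗, a, (1,l,r))` and the braiding `c`. -/

def pentT (D : Data C) : Prop := ∀ W X Y Z : C,
  D.tn.map (𝟙 W) (D.a X Y Z).hom ≫ (D.a W (D.tn.obj X Y) Z).hom
      ≫ D.tn.map (D.a W X Y).hom (𝟙 Z)
    = (D.a W X (D.tn.obj Y Z)).hom ≫ (D.a (D.tn.obj W X) Y Z).hom

def triT (D : Data C) : Prop := ∀ X Y : C,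
  (D.a X D.one Y).hom ≫ D.tn.map (D.r X).hom (𝟙 Y) = D.tn.map (𝟙 X) (D.l Y).hom

/-- First hexagon axiom (B1) for the braiding. -/
def hexT1 (D : Data C) : Prop := ∀ X Y Z : C,
  (D.a X Y Z).inv ≫ (D.br X (D.tn.obj Y Z)).hom ≫ (D.a Y Z X).inv
    = D.tn.map (D.br X Y).hom (𝟙 Z) ≫ (D.a Y X Z).inv ≫ D.tn.map (𝟙 Y) (D.br X Z).hom

/-- Second hexagon axiom (B2) for the braiding. -/
def hexT2 (D : Data C) : Prop := ∀ X Y Z : C,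
  (D.a X Y Z).hom ≫ (D.br (D.tn.obj X Y) Z).hom ≫ (D.a Z X Y).hom
    = D.tn.map (𝟙 X) (D.br Y Z).hom ≫ (D.a X Z Y).hom ≫ D.tn.map (D.br X Z).hom (𝟙 Y)

/-- The braiding is a symmetry. -/
def symT (D : Data C) : Prop := ∀ A B : C,
  (D.br A B).hom ≫ (D.br B A).hom = 𝟙 (D.tn.obj A B)

/-- Compatibility of the braiding with the unit constraint `(1,l,r)`. -/
def brUnit (D : Data C) : Prop := ∀ A : C,
  (D.br D.one A).hom ≫ (D.r A).hom = (D.l A).hom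

/-! Axiom (Ann-1): compatibility of `(L^A, 𝔏)` and `(R^A, ℜ)` with `a⁺` and `c⁺`. -/

def compLaP (D : Data C) : Prop := ∀ A X Y Z : C,
  D.tn.map (𝟙 A) (D.aP X Y Z).hom ≫ (D.dl A (D.pl.obj X Y) Z).hom
      ≫ D.pl.map (D.dl A X Y).hom (𝟙 (D.tn.obj A Z))
    = (D.dl A X (D.pl.obj Y Z)).hom ≫ D.pl.map (𝟙 (D.tn.obj A X)) (D.dl A Y Z).hom
      ≫ (D.aP (D.tn.obj A X) (D.tn.obj A Y) (D.tn.obj A Z)).hom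

def compLcP (D : Data C) : Prop := ∀ A X Y : C,
  (D.dl A X Y).hom ≫ (D.cP (D.tn.obj A X) (D.tn.obj A Y)).hom
    = D.tn.map (𝟙 A) (D.cP X Y).hom ≫ (D.dl A Y X).hom

def compRaP (D : Data C) : Prop := ∀ X Y Z A : C,
  D.tn.map (D.aP X Y Z).hom (𝟙 A) ≫ (D.dr (D.pl.obj X Y) Z A).hom
      ≫ D.pl.map (D.dr X Y A).hom (𝟙 (D.tn.obj Z A))
    = (D.dr X (D.pl.obj Y Z) A).hom ≫ D.pl.map (𝟙 (D.tn.obj X A)) (D.dr Y Z A).hom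
      ≫ (D.aP (D.tn.obj X A) (D.tn.obj Y A) (D.tn.obj Z A)).hom

def compRcP (D : Data C) : Prop := ∀ X Y A : C,
  (D.dr X Y A).hom ≫ (D.cP (D.tn.obj X A) (D.tn.obj Y A)).hom
    = D.tn.map (D.cP X Y).hom (𝟙 A) ≫ (D.dr Y X A).hom

/-! Axiom (Ann-2): diagrams (1)-(4); axiom (Ann-3): diagrams (5.1), (5.2). -/

def diag1 (D : Data C) : Prop := ∀ A B X Y : C,
  (D.a A B (D.pl.obj X Y)).hom ≫ (D.dl (D.tn.obj A B) X Y).hom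
    = D.tn.map (𝟙 A) (D.dl B X Y).hom ≫ (D.dl A (D.tn.obj B X) (D.tn.obj B Y)).hom
      ≫ D.pl.map (D.a A B X).hom (D.a A B Y).hom

def diag2 (D : Data C) : Prop := ∀ X Y B A : C,
  (D.a (D.pl.obj X Y) B A).hom ≫ D.tn.map (D.dr X Y B).hom (𝟙 A)
      ≫ (D.dr (D.tn.obj X B) (D.tn.obj Y B) A).hom
    = (D.dr X Y (D.tn.obj B A)).hom ≫ D.pl.map (D.a X B A).hom (D.a Y B A).hom

def diag3 (D : Data C) : Prop := ∀ A X Y B : C,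
  (D.a A (D.pl.obj X Y) B).hom ≫ D.tn.map (D.dl A X Y).hom (𝟙 B)
      ≫ (D.dr (D.tn.obj A X) (D.tn.obj A Y) B).hom
    = D.tn.map (𝟙 A) (D.dr X Y B).hom ≫ (D.dl A (D.tn.obj X B) (D.tn.obj Y B)).hom
      ≫ D.pl.map (D.a A X B).hom (D.a A Y B).hom

def diag4 (D : Data C) : Prop := ∀ A B X Y : C,
  (D.dl (D.pl.obj A B) X Y).hom ≫ D.pl.map (D.dr A B X).hom (D.dr A B Y).hom
      ≫ v D (D.tn.obj A X) (D.tn.obj B X) (D.tn.obj A Y) (D.tn.obj B Y)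
    = (D.dr A B (D.pl.obj X Y)).hom ≫ D.pl.map (D.dl A X Y).hom (D.dl B X Y).hom

def diag51 (D : Data C) : Prop := ∀ X Y : C,
  (D.dl D.one X Y).hom ≫ D.pl.map (D.l X).hom (D.l Y).hom = (D.l (D.pl.obj X Y)).hom

def diag52 (D : Data C) : Prop := ∀ X Y : C,
  (D.dr X Y D.one).hom ≫ D.pl.map (D.r X).hom (D.r Y).hom = (D.r (D.pl.obj X Y)).hom

/-- Diagram (6) of a braided Ann-category: `(c_{A,X} ⊕ c_{A,Y}) ∘ 𝔏_{A,X,Y} = ℜ_{X,Y,A} ∘ c_{A,X⊕Y}`. -/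
def diag6 (D : Data C) : Prop := ∀ A X Y : C,
  (D.dl A X Y).hom ≫ D.pl.map (D.br A X).hom (D.br A Y).hom
    = (D.br A (D.pl.obj X Y)).hom ≫ (D.dr X Y A).hom

/-- The condition `c_{0,0} = id`. -/
def c00 (D : Data C) : Prop := (D.br D.zero D.zero).hom = 𝟙 (D.tn.obj D.zero D.zero)

/-- The axioms of an Ann-category. -/
structure IsAnn (D : Data C) : Prop where
  hPentP : pentP D
  hTriP : triP D
  hHexP : hexP D
  hSymP : symP D
  hGrpd : grpdP C
  hInv : invObjP D
  hPentT : pentT D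
  hTriT : triT D
  hCompLaP : compLaP D
  hCompLcP : compLcP D
  hCompRaP : compRaP D
  hCompRcP : compRcP D
  hD1 : diag1 D
  hD2 : diag2 D
  hD3 : diag3 D
  hD4 : diag4 D
  hD51 : diag51 D
  hD52 : diag52 D

/-- The axioms of a braided Ann-category. -/
structure IsBraidedAnn (D : Data C) extends IsAnn D : Prop where
  hHex1 : hexT1 D
  hHex2 : hexT2 D
  hD6 : diag6 D
  hC00 : c00 D

/-- A symmetric Ann-category: a braided Ann-category whose braiding is a symmetry. -/
def IsSymAnn (D : Data C) : Prop := IsBraidedAnn D ∧ symT D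

/-- `(L^A, 𝔏, L̂^A)` is a `⊕`-functor compatible with the unit constraints (a U-functor). -/
def isUL (D : Data C) (hatL : ∀ A : C, D.tn.obj A D.zero ≅ D.zero) : Prop := ∀ A X : C,
  ((D.dl A D.zero X).hom ≫ D.pl.map (hatL A).hom (𝟙 (D.tn.obj A X))
      ≫ (D.g (D.tn.obj A X)).hom = D.tn.map (𝟙 A) (D.g X).hom) ∧
  ((D.dl A X D.zero).hom ≫ D.pl.map (𝟙 (D.tn.obj A X)) (hatL A).hom
      ≫ (D.d (D.tn.obj A X)).hom = D.tn.map (𝟙 A) (D.d X).hom)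

/-- `(R^A, ℜ, R̂^A)` is a `⊕`-functor compatible with the unit constraints (a U-functor). -/
def isUR (D : Data C) (hatR : ∀ A : C, D.tn.obj D.zero A ≅ D.zero) : Prop := ∀ A X : C,
  ((D.dr D.zero X A).hom ≫ D.pl.map (hatR A).hom (𝟙 (D.tn.obj X A))
      ≫ (D.g (D.tn.obj X A)).hom = D.tn.map (D.g X).hom (𝟙 A)) ∧
  ((D.dr X D.zero A).hom ≫ D.pl.map (𝟙 (D.tn.obj X A)) (hatR A).hom
      ≫ (D.d (D.tn.obj X A)).hom = D.tn.map (D.d X).hom (𝟙 A))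

end AnnCat

namespace AnnCat

section

variable {C : Type u} [Category.{v} C]

theorem Bifunc.map_id_comp (F : Bifunc C) (A : C) {X Y Z : C} (f : X ⟶ Y) (g : Y ⟶ Z) :
    F.map (𝟙 A) (f ≫ g) = F.map (𝟙 A) f ≫ F.map (𝟙 A) g := by
  rw [← F.map_comp, Category.comp_id]

theorem Bifunc.map_comp_id (F : Bifunc C) (A : C) {X Y Z : C} (f : X ⟶ Y) (g : Y ⟶ Z) :
    F.map (f ≫ g) (𝟙 A) = F.map f (𝟙 A) ≫ F.map g (𝟙 A) := by
  rw [← F.map_comp, Category.comp_id]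

/-- The first hexagon axiom, solved for the braiding with a tensor product. -/
theorem br_tn_right {D : Data C} (h : hexT1 D) (X Y Z : C) :
    (D.br X (D.tn.obj Y Z)).hom = (D.a X Y Z).hom ≫ D.tn.map (D.br X Y).hom (𝟙 Z) ≫
      (D.a Y X Z).inv ≫ D.tn.map (𝟙 Y) (D.br X Z).hom ≫ (D.a Y Z X).hom := by
  have h := h X Y Z
  rw [Iso.inv_comp_eq, Iso.comp_inv_eq] at h
  simpa only [Category.assoc] using h

/-- Diagram (3) follows from diagrams (1) and (6) and the first hexagon axiom. -/
theorem diag3_of_diag1_of_diag6 {D : Data C} (hGrpd : grpdP C) (hHex1 : hexT1 D)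
    (hD1 : diag1 D) (hD6 : diag6 D) : diag3 D := by
  intro A X Y B
  have : ∀ {X Y : C} (f : X ⟶ Y), IsIso f := hGrpd
  rw [← cancel_epi ((D.a B A (D.pl.obj X Y)).hom ≫
    D.tn.map (D.br B A).hom (𝟙 (D.pl.obj X Y)) ≫ (D.a A B (D.pl.obj X Y)).inv ≫
    D.tn.map (𝟙 A) (D.br B (D.pl.obj X Y)).hom)]
  have hl := D.natBr (𝟙 B) (D.dl A X Y).hom
  have h6 := hD6 B (D.tn.obj A X) (D.tn.obj A Y)
  have h1 := hD1 B A X Y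
  have hn := D.natDL (D.br B A).hom (𝟙 X) (𝟙 Y)
  rw [D.pl.map_id] at hn
  have h1' := hD1 A B X Y
  rw [← Iso.eq_inv_comp] at h1'
  have h6' := congrArg (D.tn.map (𝟙 A)) (hD6 B X Y)
  simp only [Bifunc.map_id_comp] at h6'
  have hn' := D.natDL (𝟙 A) (D.br B X).hom (D.br B Y).hom
  calc
    _ = (D.br B (D.tn.obj A (D.pl.obj X Y))).hom ≫ D.tn.map (D.dl A X Y).hom (𝟙 B) ≫
          (D.dr (D.tn.obj A X) (D.tn.obj A Y) B).hom := by
      simp only [br_tn_right hHex1, Category.assoc]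
    _ = D.tn.map (𝟙 B) (D.dl A X Y).hom ≫ (D.dl B (D.tn.obj A X) (D.tn.obj A Y)).hom ≫
          D.pl.map (D.br B (D.tn.obj A X)).hom (D.br B (D.tn.obj A Y)).hom := by
      rw [h6, ← reassoc_of% hl]
    _ = (D.a B A (D.pl.obj X Y)).hom ≫ (D.dl (D.tn.obj B A) X Y).hom ≫
          D.pl.map (D.tn.map (D.br B A).hom (𝟙 X)) (D.tn.map (D.br B A).hom (𝟙 Y)) ≫
          D.pl.map (D.a A B X).inv (D.a A B Y).inv ≫
          D.pl.map (D.tn.map (𝟙 A) (D.br B X).hom) (D.tn.map (𝟙 A) (D.br B Y).hom) ≫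
          D.pl.map (D.a A X B).hom (D.a A Y B).hom := by
      simp only [br_tn_right hHex1, D.pl.map_comp, reassoc_of% h1]
    _ = _ := by
      simp only [Category.assoc]
      rw [← reassoc_of% h6', reassoc_of% hn', ← reassoc_of% hn]
      have h1'' : (D.dl (D.tn.obj A B) X Y).hom ≫ D.pl.map (D.a A B X).inv (D.a A B Y).inv =
          (D.a A B (D.pl.obj X Y)).inv ≫ D.tn.map (𝟙 A) (D.dl B X Y).hom ≫
            (D.dl A (D.tn.obj B X) (D.tn.obj B Y)).hom := by
        rw [h1']
        simp only [Category.assoc, ← D.pl.map_comp, Iso.hom_inv_id, D.pl.map_id, Category.comp_id]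
      rw [reassoc_of% h1'']

/-- Diagram (2) follows from diagrams (1), (3) and (6) and the second hexagon axiom. -/
theorem diag2_of_diag1_of_diag3_of_diag6 {D : Data C} (hGrpd : grpdP C) (hHex2 : hexT2 D)
    (hD1 : diag1 D) (hD3 : diag3 D) (hD6 : diag6 D) : diag2 D := by
  intro X Y B A
  have : ∀ {X Y : C} (f : X ⟶ Y), IsIso f := hGrpd
  rw [← cancel_epi ((D.a B A (D.pl.obj X Y)).hom ≫ (D.br (D.tn.obj B A) (D.pl.obj X Y)).hom)]
  have h6B := congrArg (fun f => D.tn.map f (𝟙 A)) (hD6 B X Y)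
  simp only [Bifunc.map_comp_id] at h6B
  have h6A := congrArg (D.tn.map (𝟙 B)) (hD6 A X Y)
  simp only [Bifunc.map_id_comp] at h6A
  have hn := D.natDR (D.br B X).hom (D.br B Y).hom (𝟙 A)
  have hn' := D.natDL (𝟙 B) (D.br A X).hom (D.br A Y).hom
  calc
    _ = D.tn.map (𝟙 B) (D.br A (D.pl.obj X Y)).hom ≫ (D.a B (D.pl.obj X Y) A).hom ≫
          D.tn.map (D.br B (D.pl.obj X Y)).hom (𝟙 A) ≫ D.tn.map (D.dr X Y B).hom (𝟙 A) ≫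
          (D.dr (D.tn.obj X B) (D.tn.obj Y B) A).hom := by
      simpa only [Category.assoc] using congrArg (· ≫ D.tn.map (D.dr X Y B).hom (𝟙 A) ≫
        (D.dr (D.tn.obj X B) (D.tn.obj Y B) A).hom) (hHex2 B A (D.pl.obj X Y))
    _ = D.tn.map (𝟙 B) (D.dl A X Y).hom ≫ (D.dl B (D.tn.obj A X) (D.tn.obj A Y)).hom ≫
          D.pl.map
            (D.tn.map (𝟙 B) (D.br A X).hom ≫ (D.a B X A).hom ≫ D.tn.map (D.br B X).hom (𝟙 A))
            (D.tn.map (𝟙 B) (D.br A Y).hom ≫ (D.a B Y A).hom ≫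
              D.tn.map (D.br B Y).hom (𝟙 A)) := by
      rw [← reassoc_of% h6B, hn, reassoc_of% (hD3 B X Y A), ← reassoc_of% h6A, reassoc_of% hn']
      simp only [D.pl.map_comp]
    _ = _ := by
      rw [← hHex2, ← hHex2]
      simp only [D.pl.map_comp, Category.assoc]
      rw [← reassoc_of% (hD6 (D.tn.obj B A) X Y), reassoc_of% (hD1 B A X Y)]

end

/-- **Proposition 3.3.** In a braided Ann-category, the commutativity of the diagrams (2) and (3)
can be deduced from the other axioms. -/
theorem stmt1 {C : Type u} [Category.{v} C] (D : Data C)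
    (hPentP : pentP D) (hTriP : triP D) (hHexP : hexP D) (hSymP : symP D)
    (hGrpd : grpdP C) (hInv : invObjP D)
    (hPentT : pentT D) (hTriT : triT D)
    (hHex1 : hexT1 D) (hHex2 : hexT2 D)
    (hCompLaP : compLaP D) (hCompLcP : compLcP D)
    (hCompRaP : compRaP D) (hCompRcP : compRcP D)
    (hD1 : diag1 D) (hD4 : diag4 D)
    (hD51 : diag51 D) (hD52 : diag52 D)
    (hD6 : diag6 D) (hC00 : c00 D) :
    diag2 D ∧ diag3 D := by
  have hD3 := diag3_of_diag1_of_diag6 hGrpd hHex1 hD1 hD6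
  exact ⟨diag2_of_diag1_of_diag3_of_diag6 hGrpd hHex2 hD1 hD3 hD6, hD3⟩

end AnnCat
end

section
/- Every symmetric Ann-category is a ring-like category; in particular, in any symmetric Ann-category the Fröhlich–Wall diagram (8) commutes: for all objects A, B, X, Y, ((c_{A,X}⊕c_{B,X})⊕(c_{A,Y}⊕c_{B,Y}))∘v_{AX,AY,BX,BY}∘(𝔏_{A,X,Y}⊕𝔏_{B,X,Y})∘(c_{X⊕Y,A}⊕c_{X⊕Y,B})∘𝔏_{X⊕Y,A,B} = (𝔏_{X,A,B}⊕𝔏_{Y,A,B})∘(c_{A⊕B,X}⊕c_{A⊕B,Y})∘𝔏_{A⊕B,X,Y}∘c_{X⊕Y,A⊕B}. -/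
open CategoryTheory

universe v u

namespace AnnCat

variable {C : Type u} [Category.{v} C]

/-- The data of a distributivity category: the data of a (braided) Ann-category together with
natural isomorphisms `L̂^A : A ⊗ O → O` and `R̂^A : O ⊗ A → O`. -/
structure DistData (C : Type u) [Category.{v} C] extends Data C where
  hatL : ∀ A : C, tn.obj A zero ≅ zero
  hatR : ∀ A : C, tn.obj zero A ≅ zero

/-! Laplaza's axioms (L1)-(L13). -/

def L1ax (E : DistData C) : Prop := (E.hatL E.zero).hom = (E.hatR E.zero).hom

def L2ax (E : DistData C) : Prop := ∀ A B : C,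
  (E.hatR (E.pl.obj A B)).hom
    = (E.dl E.zero A B).hom ≫ E.pl.map (E.hatR A).hom (E.hatR B).hom ≫ (E.g E.zero).hom

def L3ax (E : DistData C) : Prop := ∀ A B : C,
  (E.hatL (E.pl.obj A B)).hom
    = (E.dr A B E.zero).hom ≫ E.pl.map (E.hatL A).hom (E.hatL B).hom ≫ (E.d E.zero).hom

def L4ax (E : DistData C) : Prop := (E.hatL E.one).hom = (E.l E.zero).hom

def L5ax (E : DistData C) : Prop := (E.hatR E.one).hom = (E.r E.zero).hom

def L6ax (E : DistData C) : Prop := ∀ A : C,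
  (E.hatL A).hom = (E.br A E.zero).hom ≫ (E.hatR A).hom

def L7ax (E : DistData C) : Prop := ∀ A B : C,
  (E.hatR (E.tn.obj A B)).hom
    = (E.a E.zero A B).hom ≫ E.tn.map (E.hatR A).hom (𝟙 B) ≫ (E.hatR B).hom

def L8ax (E : DistData C) : Prop := ∀ A B : C,
  E.tn.map (𝟙 A) (E.hatR B).hom ≫ (E.hatL A).hom
    = (E.a A E.zero B).hom ≫ E.tn.map (E.hatL A).hom (𝟙 B) ≫ (E.hatR B).hom

def L9ax (E : DistData C) : Prop := ∀ A B : C,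
  (E.a A B E.zero).hom ≫ (E.hatL (E.tn.obj A B)).hom
    = E.tn.map (𝟙 A) (E.hatL B).hom ≫ (E.hatL A).hom

def L10ax (E : DistData C) : Prop := ∀ A B : C,
  (E.dl A E.zero B).hom ≫ E.pl.map (E.hatL A).hom (𝟙 (E.tn.obj A B))
      ≫ (E.g (E.tn.obj A B)).hom = E.tn.map (𝟙 A) (E.g B).hom

def L11ax (E : DistData C) : Prop := ∀ A B : C,
  (E.dr E.zero B A).hom ≫ E.pl.map (E.hatR A).hom (𝟙 (E.tn.obj B A))
      ≫ (E.g (E.tn.obj B A)).hom = E.tn.map (E.g B).hom (𝟙 A)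

def L12ax (E : DistData C) : Prop := ∀ A B : C,
  (E.dl A B E.zero).hom ≫ E.pl.map (𝟙 (E.tn.obj A B)) (E.hatL A).hom
      ≫ (E.d (E.tn.obj A B)).hom = E.tn.map (𝟙 A) (E.d B).hom

def L13ax (E : DistData C) : Prop := ∀ A B : C,
  (E.dr A E.zero B).hom ≫ E.pl.map (𝟙 (E.tn.obj A B)) (E.hatR B).hom
      ≫ (E.d (E.tn.obj A B)).hom = E.tn.map (E.d A).hom (𝟙 B)

/-- The axioms of a distributivity category other than (L1)-(L13): both symmetric monoidal
structures are coherent, `(L^A, 𝔏)` and `(R^A, ℜ)` are `⊕`-functors compatible with `a⁺`, `c⁺`,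
`L̂`, `R̂` are natural, and the diagrams (1)-(4), (5.1), (5.2), (6) commute. -/
structure DistCore (E : DistData C) : Prop where
  hPentP : pentP E.toData
  hTriP : triP E.toData
  hHexP : hexP E.toData
  hSymP : symP E.toData
  hPentT : pentT E.toData
  hTriT : triT E.toData
  hHexT1 : hexT1 E.toData
  hHexT2 : hexT2 E.toData
  hSymT : symT E.toData
  hNatHatL : ∀ {A A' : C} (f : A ⟶ A'),
      E.tn.map f (𝟙 E.zero) ≫ (E.hatL A').hom = (E.hatL A).hom
  hNatHatR : ∀ {A A' : C} (f : A ⟶ A'),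
      E.tn.map (𝟙 E.zero) f ≫ (E.hatR A').hom = (E.hatR A).hom
  hCompLaP : compLaP E.toData
  hCompLcP : compLcP E.toData
  hCompRaP : compRaP E.toData
  hCompRcP : compRcP E.toData
  hD1 : diag1 E.toData
  hD2 : diag2 E.toData
  hD3 : diag3 E.toData
  hD4 : diag4 E.toData
  hD51 : diag51 E.toData
  hD52 : diag52 E.toData
  hD6 : diag6 E.toData

/-- A distributivity category in the sense of Laplaza. -/
structure IsDistCat (E : DistData C) extends DistCore E : Prop where
  hL1 : L1ax E
  hL2 : L2ax E
  hL3 : L3ax E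
  hL4 : L4ax E
  hL5 : L5ax E
  hL6 : L6ax E
  hL7 : L7ax E
  hL8 : L8ax E
  hL9 : L9ax E
  hL10 : L10ax E
  hL11 : L11ax E
  hL12 : L12ax E
  hL13 : L13ax E

/-- The Fröhlich–Wall diagram (8). -/
def diag8 (D : Data C) : Prop := ∀ A B X Y : C,
  (D.dl (D.pl.obj X Y) A B).hom
      ≫ D.pl.map (D.br (D.pl.obj X Y) A).hom (D.br (D.pl.obj X Y) B).hom
      ≫ D.pl.map (D.dl A X Y).hom (D.dl B X Y).hom
      ≫ v D (D.tn.obj A X) (D.tn.obj A Y) (D.tn.obj B X) (D.tn.obj B Y)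
      ≫ D.pl.map (D.pl.map (D.br A X).hom (D.br B X).hom)
          (D.pl.map (D.br A Y).hom (D.br B Y).hom)
    = (D.br (D.pl.obj X Y) (D.pl.obj A B)).hom ≫ (D.dl (D.pl.obj A B) X Y).hom
      ≫ D.pl.map (D.br (D.pl.obj A B) X).hom (D.br (D.pl.obj A B) Y).hom
      ≫ D.pl.map (D.dl X A B).hom (D.dl Y A B).hom

/-- A ring-like category in the sense of Fröhlich and Wall: two coherent symmetric monoidal
structures `(𝒜,⊕,a⁺,c⁺)`, `(𝒜,⊗,a,c)`, a natural left distributivity isomorphism `𝔏` such that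
each `(L^A, 𝔏)` is a `⊕`-functor compatible with `a⁺` and `c⁺` and diagrams (1) and (8) hold. -/
structure IsRingLike (D : Data C) : Prop where
  hPentP : pentP D
  hTriP : triP D
  hHexP : hexP D
  hSymP : symP D
  hPentT : pentT D
  hTriT : triT D
  hHexT1 : hexT1 D
  hHexT2 : hexT2 D
  hSymT : symT D
  hCompLaP : compLaP D
  hCompLcP : compLcP D
  hD1 : diag1 D
  hD8 : diag8 D

/-- The right distributivity constraint is the one induced from `𝔏` and the braiding via
diagram (6): `ℜ_{X,Y,A} = (c_{A,X} ⊕ c_{A,Y}) ∘ 𝔏_{A,X,Y} ∘ c_{A,X⊕Y}⁻¹`. -/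
def drFormula (D : Data C) : Prop := ∀ X Y A : C,
  (D.dr X Y A).hom
    = (D.br A (D.pl.obj X Y)).inv ≫ (D.dl A X Y).hom
      ≫ D.pl.map (D.br A X).hom (D.br A Y).hom

end AnnCat

namespace AnnCat

section

variable {C : Type u} [Category.{v} C]

theorem Bifunc.map_comp_assoc (F : Bifunc C) {A B E X Y Z W : C} (f : A ⟶ B) (g : B ⟶ E)
    (h : X ⟶ Y) (k : Y ⟶ Z) (m : F.obj E Z ⟶ W) :
    F.map f h ≫ F.map g k ≫ m = F.map (f ≫ g) (h ≫ k) ≫ m := by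
  rw [F.map_comp, Category.assoc]

/-- Naturality of the inverse of the additive associativity constraint. -/
theorem natAP_inv (D : Data C) {A A' B B' X X' : C} (f : A ⟶ A') (h : B ⟶ B') (k : X ⟶ X') :
    D.pl.map (D.pl.map f h) k ≫ (D.aP A' B' X').inv
      = (D.aP A B X).inv ≫ D.pl.map f (D.pl.map h k) := by
  rw [Iso.comp_inv_eq, Category.assoc, D.natAP, Iso.inv_hom_id_assoc]

/-- Naturality of the middle four interchange. -/
theorem v_natural (D : Data C) {U U' V V' Z Z' T T' : C} (f : U ⟶ U') (h : V ⟶ V')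
    (k : Z ⟶ Z') (m : T ⟶ T') :
    D.pl.map (D.pl.map f h) (D.pl.map k m) ≫ v D U' V' Z' T'
      = v D U V Z T ≫ D.pl.map (D.pl.map f k) (D.pl.map h m) := by
  have middle : D.pl.map h (D.pl.map k m) ≫ (D.aP V' Z' T').hom
        ≫ D.pl.map (D.cP V' Z').hom (𝟙 T') ≫ (D.aP Z' V' T').inv
      = ((D.aP V Z T).hom ≫ D.pl.map (D.cP V Z).hom (𝟙 T) ≫ (D.aP Z V T).inv)
        ≫ D.pl.map k (D.pl.map h m) := by
    rw [← Category.assoc, D.natAP, Category.assoc, Category.assoc, Category.assoc, ← natAP_inv,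
      Bifunc.map_comp_assoc, Bifunc.map_comp_assoc, D.natCP, Category.comp_id, Category.id_comp]
  unfold v
  rw [← Category.assoc, natAP_inv, Category.assoc, Bifunc.map_comp_assoc, middle]
  simp only [Category.assoc]
  rw [← D.natAP, Bifunc.map_comp_assoc, Category.comp_id, Category.id_comp]
  simp only [Category.assoc]

/-- When the braiding is a symmetry, diagram (6) expresses `𝔏` after a braiding through `ℜ`. -/
theorem br_comp_dl (D : Data C) (h6 : diag6 D) (hs : symT D) (A X Y : C) :
    (D.br (D.pl.obj X Y) A).hom ≫ (D.dl A X Y).hom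
      = (D.dr X Y A).hom ≫ D.pl.map (D.br X A).hom (D.br Y A).hom := by
  have key : (D.dl A X Y).hom
      = (D.br A (D.pl.obj X Y)).hom ≫ (D.dr X Y A).hom
        ≫ D.pl.map (D.br X A).hom (D.br Y A).hom := by
    rw [← Category.assoc, ← h6 A X Y, Category.assoc, ← D.pl.map_comp, hs, hs, D.pl.map_id,
      Category.comp_id]
  rw [key, ← Category.assoc, hs, Category.id_comp]

/-- The Fröhlich–Wall diagram follows from the interchange diagram (4) and diagram (6) when the
braiding is a symmetry. -/
theorem diag8_of_diag4_of_diag6 (D : Data C) (h4 : diag4 D) (h6 : diag6 D) (hs : symT D) :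
    diag8 D := by
  intro A B X Y
  have right : (D.br (D.pl.obj X Y) (D.pl.obj A B)).hom ≫ (D.dl (D.pl.obj A B) X Y).hom
      ≫ D.pl.map (D.br (D.pl.obj A B) X).hom (D.br (D.pl.obj A B) Y).hom
      ≫ D.pl.map (D.dl X A B).hom (D.dl Y A B).hom
      = (D.dr X Y (D.pl.obj A B)).hom ≫ D.pl.map (D.dl X A B).hom (D.dl Y A B).hom := by
    rw [← Category.assoc (D.dl _ _ _).hom, h6, Category.assoc, ← Category.assoc, hs,
      Category.id_comp]
  rw [right, ← h4, Bifunc.map_comp_assoc, br_comp_dl D h6 hs, br_comp_dl D h6 hs,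
    D.pl.map_comp, Category.assoc, ← Category.assoc (D.pl.map (D.pl.map _ _) _), v_natural,
    Category.assoc, ← D.pl.map_comp, ← D.pl.map_comp, ← D.pl.map_comp]
  simp only [hs _ _, D.pl.map_id, Category.comp_id]

end

/-- **Proposition 6.1.** Every symmetric Ann-category is a ring-like category; in particular, in
any symmetric Ann-category the Fröhlich–Wall diagram (8) commutes. -/
theorem stmt9 {C : Type u} [Category.{v} C] (D : Data C) (hS : IsSymAnn D) :
    IsRingLike D ∧ diag8 D := by
  obtain ⟨h, hs⟩ := hS
  have h8 := diag8_of_diag4_of_diag6 D h.hD4 h.hD6 hs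
  exact ⟨⟨h.hPentP, h.hTriP, h.hHexP, h.hSymP, h.hPentT, h.hTriT, h.hHex1, h.hHex2, hs,
    h.hCompLaP, h.hCompLcP, h.hD1, h8⟩, h8⟩

end AnnCat
end
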